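/- Let D be a digraph containing no oriented path P(k,l,r) with k,l,r ≥ 2, k+l+r = n−1 and k ≤ l ≤ r. Then the chromatic number of D is at most 2(n−1)+l+r−k. -/

import Mathlib

/-- `ContainsP3 D k l r` : the digraph `D` contains the oriented path
`P(k,l,r)` consisting of `k` forward arcs, then `l` backward arcs, then `r`
forward arcs. -/
def ContainsP3 {V : Type*} (D : V → V → Prop) (k l r : ℕ) : Prop :=
  ∃ x : Fin (k + l + r + 1) → V, Function.Injective x ∧
    (∀ i : ℕ, ∀ _ : i < k, D (x ⟨i, by omega⟩) (x ⟨i + 1, by omega⟩)) ∧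
    (∀ i : ℕ, ∀ _ : k ≤ i ∧ i < k + l, D (x ⟨i + 1, by omega⟩) (x ⟨i, by omega⟩)) ∧
    (∀ i : ℕ, ∀ _ : k + l ≤ i ∧ i < k + l + r, D (x ⟨i, by omega⟩) (x ⟨i + 1, by omega⟩))

/-- `x m → ⋯ → x 1 → x 0` is a directed path of length `m` ending at `x 0`. -/
def IsInPath {V : Type*} (D : V → V → Prop) (m : ℕ) (x : ℕ → V) : Prop :=
  Set.InjOn x (Set.Iic m) ∧ ∀ i < m, D (x (i + 1)) (x i)

/-- The arcs of `D` with both ends in `A`. -/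
def arcsWithin {V : Type*} (D : V → V → Prop) (A : Set V) (x y : V) : Prop :=
  D x y ∧ x ∈ A ∧ y ∈ A

/-- Two directed paths of lengths `p` and `q` that share exactly their common end. -/
def IsSinkFork {V : Type*} (D : V → V → Prop) (p q : ℕ) (u w : ℕ → V) : Prop :=
  IsInPath D p u ∧ IsInPath D q w ∧ u 0 = w 0 ∧
    ∀ i ≤ p, ∀ j ≤ q, u i = w j → i = 0 ∧ j = 0

/-- A spanning forest directed away from its roots: `c` is the depth, `par` the parent. -/
def IsLevelForest {V : Type*} (D : V → V → Prop) (c : V → ℕ) (par : V → V) : Prop :=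
  ∀ v, c v = 0 ∨ (D (par v) v ∧ c (par v) + 1 = c v)

/-- A forest in which every arc that does not increase the depth leads to an ancestor. -/
def IsFinalForest {V : Type*} (D : V → V → Prop) (c : V → ℕ) (par : V → V) : Prop :=
  IsLevelForest D c par ∧ ∀ x y, D x y → c y ≤ c x → par^[c x - c y] x = y

section Paths

variable {V : Type*} {D : V → V → Prop}

lemma IsInPath.mono {D' : V → V → Prop} {m : ℕ} {x : ℕ → V} (h : IsInPath D m x)
    (hD : ∀ a b, D a b → D' a b) : IsInPath D' m x :=
  ⟨h.1, fun i hi => hD _ _ (h.2 i hi)⟩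

lemma IsInPath.reverse {m : ℕ} {x : ℕ → V} (h : IsInPath (flip D) m x) :
    IsInPath D m fun i => x (m - i) := by
  refine ⟨fun i hi j hj hij => ?_, fun i hi => ?_⟩
  · simp only [Set.mem_Iic] at hi hj
    have := h.1 (Set.mem_Iic.2 (Nat.sub_le m i)) (Set.mem_Iic.2 (Nat.sub_le m j)) hij
    omega
  · have := h.2 (m - (i + 1)) (by omega)
    rwa [show m - (i + 1) + 1 = m - i by omega] at this

lemma IsInPath.cons {m : ℕ} {x : ℕ → V} {y : V} (h : IsInPath D m x) (hy : D (x 0) y)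
    (hne : ∀ i ≤ m, x i ≠ y) : IsInPath D (m + 1) fun i => Nat.casesOn i y x := by
  refine ⟨?_, ?_⟩
  · rintro (_ | i) hi (_ | j) hj hij
    · rfl
    · exact absurd hij.symm (hne j (by simpa using hj))
    · exact absurd hij (hne i (by simpa using hi))
    · exact congrArg _ (h.1 (by simpa using hi) (by simpa using hj) hij)
  · rintro (_ | i) hi
    · exact hy
    · exact h.2 i (by omega)

lemma IsInPath.mem_of_arcsWithin {A : Set V} {m : ℕ} {x : ℕ → V}
    (h : IsInPath (arcsWithin D A) m x) (hm : 1 ≤ m) {i : ℕ} (hi : i ≤ m) : x i ∈ A := by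
  rcases Nat.lt_or_ge i m with hlt | hge
  · exact (h.2 i hlt).2.2
  · obtain ⟨j, rfl⟩ : ∃ j, i = j + 1 := ⟨i - 1, by omega⟩
    exact (h.2 j (by omega)).2.1

lemma IsSinkFork.symm {p q : ℕ} {u w : ℕ → V} (h : IsSinkFork D p q u w) :
    IsSinkFork D q p w u :=
  ⟨h.2.1, h.1, h.2.2.1.symm, fun i hi j hj hij => (h.2.2.2 j hj i hi hij.symm).symm⟩

end Paths

section Forest

variable {V : Type*} {D : V → V → Prop} {c : V → ℕ} {par : V → V}

lemma IsLevelForest.level_iterate (h : IsLevelForest D c par) (v : V) :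
    ∀ i ≤ c v, c (par^[i] v) + i = c v := by
  intro i
  induction i with
  | zero => simp
  | succ i ih =>
    intro hi
    have h1 := ih (by omega)
    rw [Function.iterate_succ_apply']
    rcases h (par^[i] v) with h0 | ⟨-, h0⟩ <;> omega

lemma IsLevelForest.isInPath (h : IsLevelForest D c par) {v : V} {m : ℕ} (hm : m ≤ c v) :
    IsInPath D m fun i => par^[i] v := by
  refine ⟨fun i hi j hj hij => ?_, fun i hi => ?_⟩
  · simp only [Set.mem_Iic] at hi hj
    have h1 := h.level_iterate v i (by omega)
    have h2 := h.level_iterate v j (by omega)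
    have h3 := congrArg c hij
    simp only at h3
    omega
  · have h1 := h.level_iterate v i (by omega)
    simp only [Function.iterate_succ_apply']
    rcases h (par^[i] v) with h0 | ⟨h0, -⟩
    · omega
    · exact h0

lemma IsLevelForest.level_lt_card [Fintype V] (h : IsLevelForest D c par) (v : V) :
    c v < Fintype.card V := by
  have h1 := (h.isInPath (le_refl (c v))).1
  have h2 : Function.Injective fun i : Fin (c v + 1) => par^[(i : ℕ)] v := fun i j hij =>
    Fin.ext (h1 (Set.mem_Iic.2 (by omega)) (Set.mem_Iic.2 (by omega)) hij)
  simpa using Fintype.card_le_of_injective _ h2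

/-- Hanging `y` below `x` when `y` is not an ancestor of `x`. -/
lemma IsLevelForest.exists_reattach [Fintype V] (h : IsLevelForest D c par) {x y : V}
    (hxy : D x y) (hle : c y ≤ c x) (hne : par^[c x - c y] x ≠ y) :
    ∃ c' par', IsLevelForest D c' par' ∧ ∑ v, c v < ∑ v, c' v := by
  classical
  have hy : c y ≤ c y ∧ par^[c y - c y] y = y := by simp
  refine ⟨fun v => if c y ≤ c v ∧ par^[c v - c y] v = y then c v + (c x + 1 - c y) else c v,
    fun v => if v = y then x else par v, fun v => ?_, ?_⟩
  · by_cases hv : v = y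
    · subst hv
      right
      simp only [if_true, if_pos hy, if_neg (fun hx : _ ∧ _ => hne hx.2)]
      exact ⟨hxy, by omega⟩
    · simp only [if_neg hv]
      rcases h v with h0 | ⟨hD, h1⟩
      · left
        rw [if_neg, h0]
        rintro ⟨ha, hb⟩
        rw [h0, Nat.zero_sub] at hb
        exact hv hb
      · right
        refine ⟨hD, ?_⟩
        have key : (c y ≤ c (par v) ∧ par^[c (par v) - c y] (par v) = y) ↔
            (c y ≤ c v ∧ par^[c v - c y] v = y) := by
          constructor
          · rintro ⟨ha, hb⟩
            refine ⟨by omega, ?_⟩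
            rwa [show c v - c y = (c (par v) - c y) + 1 by omega, Function.iterate_succ_apply]
          · rintro ⟨ha, hb⟩
            have hlt : c y ≤ c (par v) := by
              by_contra hcon
              rw [show c v - c y = 0 by omega] at hb
              exact hv hb
            refine ⟨hlt, ?_⟩
            rwa [show c v - c y = (c (par v) - c y) + 1 by omega,
              Function.iterate_succ_apply] at hb
        simp only [key]
        split_ifs <;> omega
  · refine Finset.sum_lt_sum (fun v _ => ?_) ⟨y, Finset.mem_univ y, ?_⟩
    · split_ifs <;> omega
    · rw [if_pos hy]
      omega

lemma exists_isFinalForest [Fintype V] (D : V → V → Prop) :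
    ∃ c par, IsFinalForest D c par := by
  let S : Set ℕ := {s | ∃ c par, IsLevelForest D c par ∧ ∑ v, c v = s}
  have hne : S.Nonempty := ⟨_, fun _ => 0, id, fun _ => Or.inl rfl, rfl⟩
  have hbdd : BddAbove S := by
    refine ⟨∑ _v : V, Fintype.card V, ?_⟩
    rintro _ ⟨c, par, h, rfl⟩
    exact Finset.sum_le_sum fun v _ => (h.level_lt_card v).le
  obtain ⟨c, par, h, hs⟩ := Nat.sSup_mem hne hbdd
  refine ⟨c, par, h, fun x y hxy hle => ?_⟩
  by_contra hcon
  obtain ⟨c', par', h', hlt⟩ := h.exists_reattach hxy hle hcon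
  have := le_csSup hbdd (show ∑ v, c' v ∈ S from ⟨c', par', h', rfl⟩)
  omega

lemma IsFinalForest.level_ne (h : IsFinalForest D c par) {x y : V} (hne : x ≠ y)
    (hxy : D x y) : c x ≠ c y := by
  intro he
  have := h.2 x y hxy he.ge
  rw [he, Nat.sub_self] at this
  exact hne this

/-- An arc `x → y` between vertices of sufficiently different depths creates a fork at `y`. -/
lemma IsLevelForest.exists_isSinkFork (h : IsLevelForest D c par) {x y : V} {p q : ℕ}
    (hxy : D x y) (hp : p ≤ c y) (hq : q ≤ c x)
    (hsep : c x + p < c y ∨ c y + q < c x) :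
    ∃ u w, IsSinkFork D p (q + 1) u w := by
  have hu := h.isInPath hp
  have hw := h.isInPath hq
  have hdisj : ∀ i ≤ p, ∀ j ≤ q, par^[i] y ≠ par^[j] x := by
    intro i hi j hj hij
    have h1 := h.level_iterate y i (by omega)
    have h2 := h.level_iterate x j (by omega)
    rw [hij] at h1
    omega
  refine ⟨_, _, hu, hw.cons hxy fun j hj => (hdisj 0 (by omega) j hj).symm, rfl, ?_⟩
  rintro i hi (_ | j) hj hij
  · exact ⟨hu.1 (Set.mem_Iic.2 hi) (Set.mem_Iic.2 (Nat.zero_le p)) hij, rfl⟩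
  · exact absurd hij (hdisj i hi j (by omega))

end Forest

section Colouring

variable {V : Type*} [Fintype V]

/-- Gallai–Roy: a digraph without directed path of length `m` is `m`-colourable. -/
lemma exists_colouring_of_no_isInPath (D : V → V → Prop) (m : ℕ)
    (hD : ¬ ∃ x, IsInPath D m x) :
    ∃ f : V → ℕ, (∀ v, f v < m) ∧ ∀ x y, x ≠ y → D x y → f x ≠ f y := by
  obtain ⟨c, par, h⟩ := exists_isFinalForest D
  refine ⟨c, fun v => ?_, fun x y hne hxy => h.level_ne hne hxy⟩
  by_contra hcon
  exact hD ⟨_, h.1.isInPath (not_lt.1 hcon)⟩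

/-- A digraph without a two-block path with blocks `p`, `q` is `(p + q + 1)`-colourable. -/
lemma exists_colouring_of_no_isSinkFork (D : V → V → Prop) (p q : ℕ) (hp : 1 ≤ p) (hq : 1 ≤ q)
    (hD : ¬ ∃ u w, IsSinkFork D p q u w) :
    ∃ f : V → ℕ, (∀ v, f v < p + q + 1) ∧ ∀ x y, x ≠ y → D x y → f x ≠ f y := by
  obtain ⟨c, par, h⟩ := exists_isFinalForest D
  obtain ⟨p, rfl⟩ : ∃ p', p = p' + 1 := ⟨p - 1, by omega⟩
  obtain ⟨q, rfl⟩ : ∃ q', q = q' + 1 := ⟨q - 1, by omega⟩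
  have hmod : ∀ a b : ℕ, a < b → b ≤ a + (p + 1) → a % (p + 2) ≠ b % (p + 2) := by
    intro a b hab hba he
    have hdvd := (Nat.modEq_iff_dvd' hab.le).1 he
    have := Nat.le_of_dvd (by omega) hdvd
    omega
  refine ⟨fun v => if c v < q + 1 then c v else q + 1 + c v % (p + 2), fun v => ?_,
    fun x y hne hxy => ?_⟩
  · have := Nat.mod_lt (c v) (show 0 < p + 2 by omega)
    dsimp only
    split_ifs <;> omega
  · have hlev := h.level_ne hne hxy
    dsimp only
    split_ifs with hx hy hy
    · exact hlev
    · omega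
    · omega
    · intro he
      have he' : c x % (p + 2) = c y % (p + 2) := by omega
      rcases lt_or_gt_of_ne hlev with hlt | hgt
      · refine hmod _ _ hlt ?_ he'
        by_contra hfar
        exact hD (h.1.exists_isSinkFork hxy (p := p + 1) (q := q) (by omega) (by omega)
          (Or.inl (by omega)))
      · refine hmod _ _ hgt ?_ he'.symm
        by_contra hfar
        obtain ⟨u, w, huw⟩ := h.1.exists_isSinkFork hxy (p := q + 1) (q := p) (by omega)
          (by omega) (Or.inr (by omega))
        exact hD ⟨w, u, huw.symm⟩

end Colouring

lemma containsP3_of_paths {V : Type*} {D : V → V → Prop} {k l r : ℕ} {f g h : ℕ → V}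
    (hf : IsInPath D k f) (hg : IsInPath D l g) (hh : IsInPath (flip D) r h)
    (hfg0 : f 0 = g 0) (hgh0 : g l = h 0)
    (hfg : ∀ i ≤ k, ∀ j ≤ l, f i = g j → i = 0 ∧ j = 0)
    (hgh : ∀ i ≤ l, ∀ j ≤ r, g i = h j → j = 0)
    (hfh : ∀ i ≤ k, ∀ j ≤ r, f i = h j → j = 0) : ContainsP3 D k l r := by
  set X : ℕ → V := fun t =>
    if t ≤ k then f (k - t) else if t ≤ k + l then g (t - k) else h (t - (k + l))
  have hXf : ∀ t ≤ k, X t = f (k - t) := fun t ht => if_pos ht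
  have hXg : ∀ t, k ≤ t → t ≤ k + l → X t = g (t - k) := by
    intro t ht ht'
    rcases ht.eq_or_lt with rfl | hlt
    · simpa using (hXf k le_rfl).trans (by simpa using hfg0)
    · exact (if_neg (by omega)).trans (if_pos ht')
  have hXh : ∀ t, k + l ≤ t → X t = h (t - (k + l)) := by
    intro t ht
    rcases ht.eq_or_lt with rfl | hlt
    · simpa using (hXg (k + l) (by omega) le_rfl).trans (by simpa using hgh0)
    · exact (if_neg (by omega)).trans (if_neg (by omega))
  have hinj : ∀ s t, s < t → t ≤ k + l + r → X s ≠ X t := by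
    intro s t hst ht he
    rcases le_or_gt t k with htk | htk
    · rw [hXf s (by omega), hXf t htk] at he
      have := hf.1 (Set.mem_Iic.2 (Nat.sub_le k s)) (Set.mem_Iic.2 (Nat.sub_le k t)) he
      omega
    rcases le_or_gt t (k + l) with htl | htl
    · rw [hXg t htk.le htl] at he
      rcases le_or_gt s k with hsk | hsk
      · rw [hXf s hsk] at he
        have := hfg _ (Nat.sub_le k s) _ (by omega) he
        omega
      · rw [hXg s hsk.le (by omega)] at he
        have := hg.1 (Set.mem_Iic.2 (by omega)) (Set.mem_Iic.2 (by omega)) he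
        omega
    · rw [hXh t htl.le] at he
      rcases le_or_gt s k with hsk | hsk
      · rw [hXf s hsk] at he
        have := hfh _ (Nat.sub_le k s) _ (by omega) he
        omega
      rcases le_or_gt s (k + l) with hsl | hsl
      · rw [hXg s hsk.le hsl] at he
        have := hgh _ (by omega) _ (by omega) he
        omega
      · rw [hXh s hsl.le] at he
        have := hh.1 (Set.mem_Iic.2 (by omega)) (Set.mem_Iic.2 (by omega)) he
        omega
  refine ⟨fun t => X t, fun s t he => ?_, fun i hi => ?_, fun i hi => ?_, fun i hi => ?_⟩
  · rcases lt_trichotomy s t with hlt | heq | hgt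
    · exact absurd he (hinj s t hlt (by omega))
    · exact heq
    · exact absurd he.symm (hinj t s hgt (by omega))
  · have := hf.2 (k - (i + 1)) (by omega)
    rw [show k - (i + 1) + 1 = k - i by omega] at this
    simpa only [hXf i hi.le, hXf (i + 1) hi] using this
  · have := hg.2 (i - k) (by omega)
    rw [show i - k + 1 = i + 1 - k by omega] at this
    simpa only [hXg i hi.1 hi.2.le, hXg (i + 1) (by omega) hi.2] using this
  · have : D (h (i - (k + l))) (h (i - (k + l) + 1)) := hh.2 (i - (k + l)) (by omega)
    rw [show i - (k + l) + 1 = i + 1 - (k + l) by omega] at this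
    simpa only [hXh i hi.1, hXh (i + 1) (by omega)] using this

/-- Take a maximal vertex set `B` spanning no directed path of length `k + r - 1`. Every vertex
outside `B` ends a directed path of length `k`, or starts one of length `r`, whose other vertices
lie in `B`. -/
lemma exists_maximal_pathFree_set {V : Type*} [Fintype V] (D : V → V → Prop) (k r : ℕ)
    (hk : 1 ≤ k) (hr : 1 ≤ r) :
    ∃ B : Set V, (¬ ∃ x, IsInPath D (k + r - 1) x ∧ ∀ i ≤ k + r - 1, x i ∈ B) ∧
      ∀ a ∉ B, (∃ z, IsInPath D k z ∧ z 0 = a ∧ ∀ i ≤ k, i ≠ 0 → z i ∈ B) ∨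
        ∃ z, IsInPath (flip D) r z ∧ z 0 = a ∧ ∀ i ≤ r, i ≠ 0 → z i ∈ B := by
  set m := k + r - 1 with hm
  obtain ⟨B, hB⟩ := (Set.toFinite
    {B : Set V | ¬ ∃ x, IsInPath D m x ∧ ∀ i ≤ m, x i ∈ B}).exists_maximal
      ⟨∅, fun ⟨x, _, hx⟩ => hx 0 (Nat.zero_le m)⟩
  refine ⟨B, hB.prop, fun a ha => ?_⟩
  obtain ⟨x, hx, hxB⟩ : ∃ x, IsInPath D m x ∧ ∀ i ≤ m, x i ∈ insert a B := by
    by_contra hcon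
    exact ha (hB.le_of_ge hcon (Set.subset_insert a B) (Set.mem_insert a B))
  obtain ⟨s, hs, rfl⟩ : ∃ s ≤ m, x s = a := by
    by_contra! hcon
    exact hB.prop ⟨x, hx, fun i hi => (hxB i hi).resolve_left (hcon i hi)⟩
  have hmem : ∀ i ≤ m, i ≠ s → x i ∈ B := fun i hi his =>
    (hxB i hi).resolve_left fun he => his (hx.1 (Set.mem_Iic.2 hi) (Set.mem_Iic.2 hs) he)
  rcases Nat.lt_or_ge m (s + k) with hlt | hge
  · refine Or.inr ⟨fun i => x (s - i), ⟨fun i hi j hj hij => ?_, fun i hi => ?_⟩, rfl,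
      fun i hi hi0 => hmem _ (by omega) (by omega)⟩
    · simp only [Set.mem_Iic] at hi hj
      have := hx.1 (Set.mem_Iic.2 (show s - i ≤ m by omega))
        (Set.mem_Iic.2 (show s - j ≤ m by omega)) hij
      omega
    · have := hx.2 (s - (i + 1)) (by omega)
      rwa [show s - (i + 1) + 1 = s - i by omega] at this
  · refine Or.inl ⟨fun i => x (s + i), ⟨fun i hi j hj hij => ?_, fun i hi => ?_⟩, rfl,
      fun i hi hi0 => hmem _ (by omega) (by omega)⟩
    · simp only [Set.mem_Iic] at hi hj
      have := hx.1 (Set.mem_Iic.2 (show s + i ≤ m by omega))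
        (Set.mem_Iic.2 (show s + j ≤ m by omega)) hij
      omega
    · exact hx.2 (s + i) (by omega)

/-- A digraph without `P(k,l,r)` has a proper colouring with `2 (k + l + r) + 1` colours. -/
lemma exists_colouring_of_not_containsP3 {V : Type*} [Fintype V] (D : V → V → Prop) (k l r : ℕ)
    (hk : 1 ≤ k) (hl : 1 ≤ l) (hr : 1 ≤ r) (hkr : 2 ≤ k + r - 1) (hD : ¬ ContainsP3 D k l r) :
    ∃ f : V → ℕ, (∀ v, f v < 2 * (k + l + r) + 1) ∧ ∀ x y, x ≠ y → D x y → f x ≠ f y := by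
  classical
  obtain ⟨B, hB, hcover⟩ := exists_maximal_pathFree_set D k r hk hr
  obtain ⟨f₀, hf₀, hp₀⟩ := exists_colouring_of_no_isInPath (arcsWithin D B) (k + r - 1) (by
    rintro ⟨x, hx⟩
    exact hB ⟨x, hx.mono fun _ _ h => h.1, fun i hi => hx.mem_of_arcsWithin (by omega) hi⟩)
  set A : Set V := {a | a ∉ B ∧ ∃ z, IsInPath D k z ∧ z 0 = a ∧ ∀ i ≤ k, i ≠ 0 → z i ∈ B}
  set C : Set V :=
    {a | a ∉ B ∧ ∃ z, IsInPath (flip D) r z ∧ z 0 = a ∧ ∀ i ≤ r, i ≠ 0 → z i ∈ B}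
  obtain ⟨f₁, hf₁, hp₁⟩ :=
      exists_colouring_of_no_isSinkFork (arcsWithin (flip D) A) l r hl hr (by
    rintro ⟨u, w, hu, hw, h0, hdisj⟩
    have huA : ∀ i ≤ l, u i ∈ A := fun i hi => hu.mem_of_arcsWithin hl hi
    have hwA : ∀ i ≤ r, w i ∈ A := fun i hi => hw.mem_of_arcsWithin hr hi
    obtain ⟨z, hz, hz0, hzB⟩ := (huA l le_rfl).2
    have hsep : ∀ i ≤ k, ∀ a ∈ A, z i = a → i = 0 := by
      intro i hi a ha he
      by_contra hi0
      exact ha.1 (he ▸ hzB i hi hi0)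
    refine hD (containsP3_of_paths hz (hu.mono fun _ _ h => h.1).reverse
      (hw.mono fun _ _ h => h.1) (by simpa using hz0) (by simpa using h0) ?_ ?_ ?_)
    · intro i hi j hj he
      have hi0 := hsep i hi _ (huA _ (Nat.sub_le l j)) he
      subst hi0
      rw [hz0] at he
      have := hu.1 (Set.mem_Iic.2 le_rfl) (Set.mem_Iic.2 (Nat.sub_le l j)) he
      omega
    · intro i hi j hj he
      exact (hdisj _ (Nat.sub_le l i) j hj he).2
    · intro i hi j hj he
      have hi0 := hsep i hi _ (hwA j hj) he
      subst hi0
      rw [hz0] at he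
      exact (hdisj l le_rfl j hj he).2)
  obtain ⟨f₂, hf₂, hp₂⟩ :=
      exists_colouring_of_no_isSinkFork (arcsWithin D C) k l hk hl (by
    rintro ⟨u, w, hu, hw, h0, hdisj⟩
    have huC : ∀ i ≤ k, u i ∈ C := fun i hi => hu.mem_of_arcsWithin hk hi
    have hwC : ∀ i ≤ l, w i ∈ C := fun i hi => hw.mem_of_arcsWithin hl hi
    obtain ⟨z, hz, hz0, hzB⟩ := (hwC l le_rfl).2
    have hsep : ∀ j ≤ r, ∀ a ∈ C, a = z j → j = 0 := by
      intro j hj a ha he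
      by_contra hj0
      exact ha.1 (he ▸ hzB j hj hj0)
    exact hD (containsP3_of_paths (hu.mono fun _ _ h => h.1) (hw.mono fun _ _ h => h.1) hz h0
      hz0.symm hdisj (fun i hi j hj he => hsep j hj _ (hwC i hi) he)
      fun i hi j hj he => hsep j hj _ (huC i hi) he))
  have hAC : ∀ v, v ∉ B → v ∉ A → v ∈ C := fun v hv hvA =>
    ⟨hv, (hcover v hv).resolve_left fun h => hvA ⟨hv, h⟩⟩
  refine ⟨fun v => if v ∈ B then f₀ v else if v ∈ A then k + r - 1 + f₁ v
    else k + r - 1 + (l + r + 1) + f₂ v, fun v => ?_, fun x y hne hxy => ?_⟩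
  · have h0 := hf₀ v
    have h1 := hf₁ v
    have h2 := hf₂ v
    dsimp only
    split_ifs <;> omega
  · have h0x := hf₀ x
    have h1x := hf₁ x
    have h0y := hf₀ y
    have h1y := hf₁ y
    dsimp only
    split_ifs with hx hy hy' hxA hy hyA hy hyA
    · exact hp₀ x y hne ⟨hxy, hx, hy⟩
    · omega
    · omega
    · omega
    · have := hp₁ y x hne.symm ⟨hxy, hyA, hxA⟩
      omega
    · omega
    · omega
    · omega
    · have := hp₂ x y hne ⟨hxy, hAC x hx hxA, hAC y hy hyA⟩
      omega

/-- Case 2 of Theorem 3.1: a `P(k,l,r)`-free digraph with `k+l+r = n-1`, `k,l,r ≥ 2`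
and `k ≤ l ≤ r` has chromatic number at most `2 * (n - 1) + l + r - k`. -/
theorem three_blocks_case_2 {V : Type*} [Fintype V] (D : V → V → Prop) (n k l r : ℕ)
    (hk : 2 ≤ k) (hl : 2 ≤ l) (hr : 2 ≤ r)
    (hsum : k + l + r = n - 1) (h1 : k ≤ l) (h2 : l ≤ r)
    (hfree : ¬ ContainsP3 D k l r) :
    (SimpleGraph.fromRel D).chromaticNumber ≤ ((2 * (n - 1) + l + r - k : ℕ) : ℕ∞) := by
  obtain ⟨f, hf, hp⟩ := exists_colouring_of_not_containsP3 D k l r (by omega) (by omega)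
    (by omega) (by omega) hfree
  let col : (SimpleGraph.fromRel D).Coloring (Fin (2 * (n - 1) + l + r - k)) :=
    SimpleGraph.Coloring.mk (fun v => ⟨f v, by have := hf v; omega⟩) (by
      intro x y hxy he
      rw [SimpleGraph.fromRel_adj] at hxy
      have he' : f x = f y := congrArg Fin.val he
      rcases hxy with ⟨hne, h | h⟩
      · exact hp x y hne h he'
      · exact hp y x hne.symm h he'.symm)
  exact SimpleGraph.Colorable.chromaticNumber_le ⟨col⟩
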